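/- arXiv:2210.10686 — 2 statements merged into one kernel-verified Lean document; each statement's English description precedes it below -/
import Mathlib

section
/- Let F be a quasimodular form of weight K and depth ≤ n on a lattice Γ ⊂ SL₂(ℝ), meaning F is holomorphic on ℍ of moderate growth and there exist holomorphic functions F₀ = F, F₁, ..., F_n on ℍ such that (F|_K γ)(τ) = Σ_{r=0}^n F_r(τ)·((1/(2πi))·c/(cτ+d))^r for all γ = [[a,b],[c,d]] ∈ Γ. Then the coefficient functions are unique, and setting δ(F) := F₁, one has F_r = δ^r(F)/r! for all r ≥ 0. -/
open Complex Finset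

noncomputable section

abbrev SL2R := Matrix.SpecialLinearGroup (Fin 2) ℝ

instance : TopologicalSpace SL2R := instTopologicalSpaceSubtype

/-- The upper half-plane, as a subset of `ℂ`. -/
def UHP : Set ℂ := {z : ℂ | 0 < z.im}

/-- Möbius action of `γ ∈ SL₂(ℝ)` on the upper half-plane. -/
def mact (γ : SL2R) (τ : ℂ) : ℂ :=
  ((γ.1 0 0 : ℝ) * τ + (γ.1 0 1 : ℝ)) / ((γ.1 1 0 : ℝ) * τ + (γ.1 1 1 : ℝ))

/-- Weight `K` slash action: `(f|_K γ)(τ) = (cτ+d)^{-K} f(γτ)`. -/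
def slashK (K : ℤ) (γ : SL2R) (f : ℂ → ℂ) (τ : ℂ) : ℂ :=
  ((γ.1 1 0 : ℝ) * τ + (γ.1 1 1 : ℝ)) ^ (-K) * f (mact γ τ)

/-- A lattice in `SL₂(ℝ)`: a discrete subgroup of finite covolume, expressed via a measurable
set of representatives of finite hyperbolic area for the action on the upper half-plane. -/
def IsLattice (Γ : Subgroup SL2R) : Prop :=
  DiscreteTopology Γ ∧
    ∃ F : Set ℂ, F ⊆ UHP ∧ MeasurableSet F ∧
      (∀ τ ∈ UHP, ∃ γ ∈ Γ, mact γ τ ∈ F) ∧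
      (∫⁻ z in F, ENNReal.ofReal (1 / z.im ^ 2)) < ⊤

/-- Moderate growth of a function on the upper half-plane. -/
def ModerateGrowth (f : ℂ → ℂ) : Prop :=
  ∃ C : ℝ, ∃ N : ℕ, ∀ τ : ℂ, 0 < τ.im → ‖f τ‖ ≤ C * (τ.im + τ.im⁻¹) ^ N

/-- `F` has the quasimodular transformation behaviour of weight `K` and depth `≤ n` on `Γ`,
with coefficient functions `G r`:
`(F|_K γ)(τ) = Σ_{r=0}^n (G r)(τ)·((1/(2πi))·c/(cτ+d))^r` for all `γ ∈ Γ`. -/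
def HasQMExpansion (Γ : Subgroup SL2R) (K : ℤ) (n : ℕ) (F : ℂ → ℂ) (G : ℕ → ℂ → ℂ) : Prop :=
  ∀ γ ∈ Γ, ∀ τ : ℂ, 0 < τ.im →
    slashK K γ F τ =
      ∑ r ∈ Finset.range (n + 1),
        G r τ * ((1 / (2 * ↑Real.pi * I)) *
          ((γ.1 1 0 : ℝ) / ((γ.1 1 0 : ℝ) * τ + (γ.1 1 1 : ℝ)))) ^ r

open MeasureTheory
open UpperHalfPlane hiding I
open scoped Pointwise

/-- If the translates of `R` under a countable group cover `A`, and only finitely many group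
elements move `A` onto a set meeting `A`, then the measure of `R` bounds that of `A`. -/
theorem measure_le_card_mul_of_subset_iUnion_smul {G X : Type*} [Group G] [Countable G]
    [MulAction G X] [MeasurableSpace X] [MeasurableConstSMul G X] (μ : Measure X)
    [SMulInvariantMeasure G X μ] {A R : Set X} (hA : MeasurableSet A)
    (hfin : {g : G | (((g • ·) '' A) ∩ A).Nonempty}.Finite) (hsub : A ⊆ ⋃ g : G, g • R) :
    μ A ≤ hfin.toFinset.card * μ R := by
  have hcount (x : X) : ∑' g : G, (g⁻¹ • A).indicator (1 : X → ENNReal) x ≤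
      hfin.toFinset.card := by
    by_cases hx : ∃ g₀ : G, g₀ • x ∈ A
    · obtain ⟨g₀, hg₀⟩ := hx
      rw [← (Equiv.mulRight g₀).tsum_eq]
      calc _ ≤ ∑' h : G, {g : G | (((g • ·) '' A) ∩ A).Nonempty}.indicator
              (fun _ ↦ (1 : ENNReal)) h := by
            refine ENNReal.tsum_le_tsum fun h ↦ ?_
            classical
            rw [Set.indicator_apply]
            split_ifs with hh
            · rw [Set.indicator_of_mem]
              · rfl
              · refine ⟨h • g₀ • x, ⟨g₀ • x, hg₀, rfl⟩, ?_⟩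
                simpa [Set.mem_inv_smul_set_iff, mul_smul] using hh
            · exact zero_le
        _ = _ := by
            rw [← _root_.tsum_subtype, ENNReal.tsum_set_one, hfin.encard_eq_coe_toFinset_card]
            simp
    · push Not at hx
      simp [Set.mem_inv_smul_set_iff, hx]
  calc μ A ≤ ∑' g : G, μ (A ∩ g • R) := by
        refine le_trans (measure_mono ?_) (measure_iUnion_le _)
        rw [← Set.inter_iUnion]
        exact Set.subset_inter subset_rfl hsub
    _ = ∑' g : G, ∫⁻ x in R, (g⁻¹ • A).indicator 1 x ∂μ := by
        congr! 2 with g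
        rw [lintegral_indicator_one (hA.const_smul _), Measure.restrict_apply (hA.const_smul _),
          ← measure_smul μ g⁻¹, Set.smul_set_inter, inv_smul_smul]
    _ = ∫⁻ x in R, ∑' g : G, (g⁻¹ • A).indicator 1 x ∂μ :=
        (lintegral_tsum fun g ↦ (measurable_one.indicator (hA.const_smul _)).aemeasurable).symm
    _ ≤ ∫⁻ _ in R, hfin.toFinset.card ∂μ := lintegral_mono hcount
    _ = _ := by simp

instance smulInvariantMeasure_SL2R : SMulInvariantMeasure SL2R ℍ volume :=
  ⟨fun g s _ ↦ measure_preimage_smul (volume : Measure ℍ)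
    (Matrix.SpecialLinearGroup.mapGL ℝ g) s⟩

theorem volume_pos_of_isOpen {U : Set ℍ} (hU : IsOpen U) (hne : U.Nonempty) : 0 < volume U := by
  rw [volume_eq_lintegral]
  have ho : IsOpen ((↑) '' U : Set ℂ) := isOpenEmbedding_coe.isOpenMap _ hU
  rw [setLIntegral_pos_iff (by fun_prop)]
  refine lt_of_lt_of_le (ho.measure_pos volume (hne.image _)) (measure_mono ?_)
  rintro _ ⟨z, hz, rfl⟩
  exact ⟨by simp [z.im_ne_zero], z, hz, rfl⟩

/-- Scaling of the imaginary part. -/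
def imScale (s : ℝ) (hs : 0 < s) (z : ℍ) : ℍ := ⟨⟨z.re, s * z.im⟩, mul_pos hs z.im_pos⟩

/-- Scaling of the imaginary part, as a linear map. -/
def imScaleCLM (s : ℝ) : ℂ →L[ℝ] ℂ :=
  (Matrix.toLin basisOneI basisOneI !![1, 0; 0, s]).toContinuousLinearMap

theorem imScaleCLM_apply (s : ℝ) (z : ℂ) : imScaleCLM s z = ⟨z.re, s * z.im⟩ := by
  apply Complex.ext <;>
  simp [imScaleCLM, Matrix.toLin_apply, Matrix.mulVec, dotProduct, Fin.sum_univ_two]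

theorem det_imScaleCLM (s : ℝ) : (imScaleCLM s).det = s := by
  simp [imScaleCLM, ContinuousLinearMap.det]

theorem volume_imScale_image (s : ℝ) (hs : 0 < s) {R : Set ℍ} (hR : MeasurableSet R) :
    volume (imScale s hs '' R) = ENNReal.ofReal s⁻¹ * volume R := by
  have hco (z : ℍ) : ((imScale s hs z : ℍ) : ℂ) = imScaleCLM s z := by
    rw [imScaleCLM_apply]; rfl
  have hinj : Set.InjOn (imScaleCLM s) ((↑) '' R : Set ℂ) := by
    intro a _ b _ h
    rw [imScaleCLM_apply, imScaleCLM_apply, Complex.mk.injEq] at h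
    exact Complex.ext h.1 (mul_left_cancel₀ hs.ne' h.2)
  have key := lintegral_image_eq_lintegral_abs_det_fderiv_mul volume
    (measurableEmbedding_coe.measurableSet_image.mpr hR)
    (fun x _ ↦ (imScaleCLM s).hasFDerivAt.hasFDerivWithinAt) hinj
    (fun z ↦ ↑((1 / ‖z.im‖₊) ^ 2 : NNReal))
  rw [volume_eq_lintegral, volume_eq_lintegral, ← lintegral_const_mul' _ _ ENNReal.ofReal_ne_top]
  have him : ((↑) '' (imScale s hs '' R) : Set ℂ) = imScaleCLM s '' ((↑) '' R) := by
    simp only [Set.image_image, hco]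
  rw [him, key]
  refine setLIntegral_congr_fun (measurableEmbedding_coe.measurableSet_image.mpr hR) ?_
  rintro _ ⟨z, -, rfl⟩
  simp only [det_imScaleCLM, imScaleCLM_apply, ENNReal.ofReal]
  norm_cast
  ext
  have := z.im_ne_zero
  simp [abs_of_pos hs, hs.le, nnnorm_mul]
  field_simp
  exact (sq_abs _).symm

theorem coe_smul_eq_mact (γ : SL2R) (z : ℍ) : ((γ • z : ℍ) : ℂ) = mact γ z := by
  simp [coe_specialLinearGroup_apply, mact]

theorem imScale_smul (s : ℝ) (hs : 0 < s) (p : SL2R) (hp : p.1 1 0 = 0) (z : ℍ) :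
    imScale s hs (p • z) = p • imScale s hs z := by
  have hdet := p.2
  rw [Matrix.det_fin_two, hp, mul_zero, sub_zero] at hdet
  have hd : p.1 1 1 = (p.1 0 0)⁻¹ := eq_inv_of_mul_eq_one_right hdet
  have hc (w : ℍ) : ((p • w : ℍ) : ℂ) = (p.1 0 0 * w + p.1 0 1) * p.1 0 0 := by
    rw [coe_smul_eq_mact, mact, hp, hd]
    simp
  have hre (w : ℍ) := congrArg Complex.re (hc w)
  have him (w : ℍ) := congrArg Complex.im (hc w)
  simp at hre him
  apply UpperHalfPlane.ext
  apply Complex.ext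
  · change (p • z).re = (p • imScale s hs z).re
    rw [hre, hre]
    simp [imScale]
  · change s * (p • z).im = (p • imScale s hs z).im
    rw [him, him]
    simp [imScale]
    ring

theorem lower_left_mul_inv (γ t : SL2R) :
    (γ * t⁻¹).1 1 0 = γ.1 1 0 * t.1 1 1 - γ.1 1 1 * t.1 1 0 := by
  simp [Matrix.mul_apply, Fin.sum_univ_two, Matrix.adjugate_fin_two, sub_eq_add_neg]

theorem denom_ne_zero_of_im_pos (γ : SL2R) {τ : ℂ} (hτ : 0 < τ.im) :
    ((γ.1 1 0 : ℝ) * τ + (γ.1 1 1 : ℝ) : ℂ) ≠ 0 := by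
  simpa [UpperHalfPlane.denom] using
    UpperHalfPlane.denom_ne_zero (Matrix.SpecialLinearGroup.mapGL ℝ γ) ⟨τ, hτ⟩

/-- The point `∞` has infinite orbit under a lattice: finitely many elements `t` of `Γ` cannot
account for all the cosets of upper triangular elements. -/
theorem IsLattice.exists_forall_lower_left_ne_zero {Γ : Subgroup SL2R} (hΓ : IsLattice Γ)
    (T : Set SL2R) (hT : T.Finite) (hTΓ : T ⊆ Γ) :
    ∃ γ ∈ Γ, ∀ t ∈ T, (γ * t⁻¹).1 1 0 ≠ 0 := by
  by_contra! hcon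
  obtain ⟨hdisc, F, hFU, hFm, hFcov, hFfin⟩ := hΓ
  have : @DiscreteTopology Γ (@instTopologicalSpaceSubtype _ _
    Matrix.SpecialLinearGroup.instTopologicalSpace) := hdisc
  have : SecondCountableTopology (Matrix (Fin 2) (Fin 2) ℝ) :=
    inferInstanceAs (SecondCountableTopology (Fin 2 → Fin 2 → ℝ))
  have : SecondCountableTopology SL2R :=
    Matrix.SpecialLinearGroup.isClosedEmbedding_val.isEmbedding.secondCountableTopology
  have : Countable Γ := countable_of_Lindelof_of_discrete
  set E : Set ℍ := (↑) ⁻¹' F with hE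
  have hEm : MeasurableSet E := measurable_coe hFm
  have hEfin : volume E < ⊤ := by
    rw [volume_eq_lintegral, Set.image_preimage_eq_of_subset]
    · convert hFfin using 3 with z
      rw [ENNReal.ofReal, ENNReal.coe_inj]
      ext
      simp [sq_nonneg]
    · intro z hz
      exact ⟨⟨z, hFU hz⟩, rfl⟩
  set R : Set ℍ := ⋃ t ∈ T, t • E with hR
  have hRm : MeasurableSet R := .biUnion hT.countable fun t _ ↦ hEm.const_smul t
  have hRfin : volume R < ⊤ :=
    measure_biUnion_lt_top hT fun t _ ↦ by rwa [measure_smul]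
  set A : Set ℍ := Metric.closedBall UpperHalfPlane.I 1
  have hAm : MeasurableSet A := Metric.isClosed_closedBall.measurableSet
  have hAc : IsCompact A := isCompact_closedBall _ _
  have hfin : {g : Γ | (((g • ·) '' A) ∩ A).Nonempty}.Finite := by
    simpa [Set.nonempty_iff_ne_empty] using
      ProperlyDiscontinuousSMul.finite_disjoint_inter_image (Γ := Γ) hAc hAc
  have hApos : 0 < volume A :=
    (volume_pos_of_isOpen Metric.isOpen_ball ⟨UpperHalfPlane.I, by simp⟩).trans_le
      (measure_mono Metric.ball_subset_closedBall)
  have hbound (s : ℝ) (hs : 0 < s) :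
      volume A ≤ hfin.toFinset.card * (ENNReal.ofReal s⁻¹ * volume R) := by
    rw [← volume_imScale_image s hs hRm]
    refine measure_le_card_mul_of_subset_iUnion_smul volume hAm hfin fun z _ ↦ ?_
    set w := imScale s⁻¹ (inv_pos.mpr hs) z with hw
    have hzw : imScale s hs w = z := by
      apply UpperHalfPlane.ext
      apply Complex.ext
      · rfl
      · change s * (s⁻¹ * z.im) = z.im
        field_simp
    obtain ⟨γ, hγ, hγF⟩ := hFcov w w.im_pos
    obtain ⟨t, ht, hlow⟩ := hcon γ⁻¹ (inv_mem hγ)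
    refine Set.mem_iUnion.mpr ⟨⟨γ⁻¹ * t⁻¹, mul_mem (inv_mem hγ) (inv_mem (hTΓ ht))⟩, ?_⟩
    refine ⟨imScale s hs (t • γ • w), ⟨_, Set.mem_biUnion ht ⟨γ • w, ?_, rfl⟩, rfl⟩, ?_⟩
    · rwa [hE, Set.mem_preimage, coe_smul_eq_mact]
    · change (γ⁻¹ * t⁻¹) • _ = z
      rw [← imScale_smul s hs _ hlow, mul_smul, inv_smul_smul, inv_smul_smul, hzw]
  have hlim : Filter.Tendsto (fun s : ℝ ↦
      (hfin.toFinset.card : ENNReal) * (ENNReal.ofReal s⁻¹ * volume R)) Filter.atTop (nhds 0) := by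
    have h1 : Filter.Tendsto (fun s : ℝ ↦ ENNReal.ofReal s⁻¹) Filter.atTop (nhds 0) := by
      simpa using ENNReal.tendsto_ofReal tendsto_inv_atTop_zero
    have h2 := ENNReal.Tendsto.mul_const (b := volume R) h1 (Or.inr hRfin.ne)
    have h3 := ENNReal.Tendsto.const_mul (a := (hfin.toFinset.card : ENNReal)) h2
      (Or.inr (ENNReal.natCast_ne_top _))
    simpa using h3
  exact hApos.not_ge (ge_of_tendsto hlim
    ((Filter.eventually_gt_atTop 0).mono fun s hs ↦ hbound s hs))

theorem IsLattice.infinite_range {Γ : Subgroup SL2R} (hΓ : IsLattice Γ) {τ : ℂ} (hτ : 0 < τ.im) :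
    (Set.range fun γ : Γ ↦
      ((γ.1.1 1 0 : ℝ) / ((γ.1.1 1 0 : ℝ) * τ + (γ.1.1 1 1 : ℝ)) : ℂ)).Infinite := by
  intro hfin
  have := hfin.to_subtype
  set f := fun γ : Γ ↦
    ((γ.1.1 1 0 : ℝ) / ((γ.1.1 1 0 : ℝ) * τ + (γ.1.1 1 1 : ℝ)) : ℂ) with hf
  obtain ⟨γ, hγ, hne⟩ := hΓ.exists_forall_lower_left_ne_zero
    (Set.range fun v : Set.range f ↦ (v.2.choose : SL2R)) (Set.finite_range _)
    (Set.range_subset_iff.mpr fun v ↦ v.2.choose.2)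
  set v : Set.range f := ⟨f ⟨γ, hγ⟩, ⟨γ, hγ⟩, rfl⟩ with hv
  refine hne _ ⟨v, rfl⟩ ?_
  have hval : f v.2.choose = f ⟨γ, hγ⟩ := v.2.choose_spec
  change (γ * (v.2.choose : SL2R)⁻¹).1 1 0 = 0
  rw [lower_left_mul_inv]
  simp only [hf] at hval
  rw [div_eq_div_iff (denom_ne_zero_of_im_pos _ hτ) (denom_ne_zero_of_im_pos _ hτ)] at hval
  generalize (v.2.choose : SL2R) = t at hval ⊢
  have : ((γ.1 1 0 * t.1 1 1 - γ.1 1 1 * t.1 1 0 : ℝ) : ℂ) = 0 := by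
    push_cast
    linear_combination -hval
  exact_mod_cast this

open Polynomial in
theorem sum_mul_pow_eq_imp_coeff_eq {S : Set ℂ} (hS : S.Infinite) (n : ℕ) (a b : ℕ → ℂ)
    (h : ∀ x ∈ S, ∑ r ∈ range (n + 1), a r * x ^ r = ∑ r ∈ range (n + 1), b r * x ^ r) :
    ∀ r ≤ n, a r = b r := by
  have hpq : ∑ r ∈ range (n + 1), C (a r) * X ^ r = ∑ r ∈ range (n + 1), C (b r) * X ^ r :=
    Polynomial.eq_of_infinite_eval_eq _ _ (hS.mono fun x hx ↦ by
      simpa [Polynomial.eval_finsetSum] using h x hx)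
  intro r hr
  simpa [Polynomial.finsetSum_coeff, Polynomial.coeff_C_mul_X_pow, Nat.lt_succ_iff, hr] using
    congrArg (fun p : ℂ[X] ↦ p.coeff r) hpq

/-- Binomial re-expansion of a polynomial around `x`. -/
theorem sum_mul_add_pow_eq (n : ℕ) (a : ℕ → ℂ) (x y : ℂ) :
    ∑ m ∈ range (n + 1), a m * (x + y) ^ m =
      ∑ r ∈ range (n + 1),
        (∑ s ∈ range (n - r + 1), ((r + s).choose s : ℂ) * a (r + s) * x ^ s) * y ^ r := by
  have h1 : ∀ m ∈ range (n + 1), a m * (x + y) ^ m =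
      ∑ s ∈ range (m + 1), (m.choose s : ℂ) * a m * x ^ s * y ^ (m - s) := fun m _ ↦ by
    rw [add_pow, mul_sum]
    exact sum_congr rfl fun s _ ↦ by ring
  rw [sum_congr rfl h1]
  simp_rw [sum_mul]
  rw [Finset.sum_sigma', Finset.sum_sigma']
  refine sum_bij' (fun p _ ↦ ⟨p.1 - p.2, p.2⟩) (fun p _ ↦ ⟨p.1 + p.2, p.2⟩) ?_ ?_ ?_ ?_ ?_
  · rintro ⟨m, s⟩ h
    simp at h ⊢
    omega
  · rintro ⟨m, s⟩ h
    simp at h ⊢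
    omega
  · rintro ⟨m, s⟩ h
    simp at h ⊢
    omega
  · rintro ⟨m, s⟩ h
    simp
  · rintro ⟨m, s⟩ h
    simp only [mem_sigma, mem_range, Nat.lt_succ_iff] at h
    simp [Nat.sub_add_cancel h.2]

theorem mact_im_pos (γ : SL2R) {τ : ℂ} (hτ : 0 < τ.im) : 0 < (mact γ τ).im := by
  have := (γ • (⟨τ, hτ⟩ : ℍ)).im_pos
  rwa [← UpperHalfPlane.coe_im, coe_smul_eq_mact] at this

theorem mact_mul (γ η : SL2R) {τ : ℂ} (hτ : 0 < τ.im) :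
    mact (γ * η) τ = mact γ (mact η τ) := by
  have := congrArg UpperHalfPlane.coe (mul_smul γ η (⟨τ, hτ⟩ : ℍ))
  simpa only [coe_smul_eq_mact] using this

theorem mact_mul_denom (η : SL2R) {τ : ℂ} (hτ : 0 < τ.im) :
    mact η τ * ((η.1 1 0 : ℝ) * τ + (η.1 1 1 : ℝ)) = (η.1 0 0 : ℝ) * τ + (η.1 0 1 : ℝ) :=
  div_mul_cancel₀ _ (denom_ne_zero_of_im_pos η hτ)

/-- Cocycle relation for the automorphy factor. -/
theorem denom_mul (γ η : SL2R) {τ : ℂ} (hτ : 0 < τ.im) :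
    (((γ * η).1 1 0 : ℝ) * τ + ((γ * η).1 1 1 : ℝ) : ℂ) =
      ((γ.1 1 0 : ℝ) * mact η τ + (γ.1 1 1 : ℝ)) * ((η.1 1 0 : ℝ) * τ + (η.1 1 1 : ℝ)) := by
  have h := mact_mul_denom η hτ
  simp only [Matrix.SpecialLinearGroup.coe_mul, Matrix.mul_apply, Fin.sum_univ_two]
  push_cast
  linear_combination (-(γ.1 1 0 : ℝ) : ℂ) * h

/-- Cocycle relation for the logarithmic derivative of the automorphy factor. -/
theorem logDeriv_denom_mul (γ η : SL2R) {τ : ℂ} (hτ : 0 < τ.im) :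
    (((γ * η).1 1 0 : ℝ) / (((γ * η).1 1 0 : ℝ) * τ + ((γ * η).1 1 1 : ℝ)) : ℂ) =
      (η.1 1 0 : ℝ) / ((η.1 1 0 : ℝ) * τ + (η.1 1 1 : ℝ)) +
      (((η.1 1 0 : ℝ) * τ + (η.1 1 1 : ℝ)) ^ 2)⁻¹ *
        ((γ.1 1 0 : ℝ) / ((γ.1 1 0 : ℝ) * mact η τ + (γ.1 1 1 : ℝ))) := by
  have h1 := denom_ne_zero_of_im_pos η hτ
  have h2 := denom_ne_zero_of_im_pos γ (mact_im_pos η hτ)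
  have h3 := mact_mul_denom η hτ
  have hdet : ((η.1 0 0 : ℝ) : ℂ) * (η.1 1 1 : ℝ) - (η.1 0 1 : ℝ) * (η.1 1 0 : ℝ) = 1 := by
    have := η.2
    rw [Matrix.det_fin_two] at this
    exact_mod_cast this
  have hc : (((γ * η).1 1 0 : ℝ) : ℂ) =
      (γ.1 1 0 : ℝ) * (η.1 0 0 : ℝ) + (γ.1 1 1 : ℝ) * (η.1 1 0 : ℝ) := by
    simp [Matrix.mul_apply, Fin.sum_univ_two]
  rw [denom_mul γ η hτ, hc]
  field_simp
  linear_combination (-(η.1 1 0 : ℝ) * (γ.1 1 0 : ℝ) : ℂ) * h3 + (γ.1 1 0 : ℂ) * hdet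

theorem slashK_mul (K : ℤ) (γ η : SL2R) (f : ℂ → ℂ) {τ : ℂ} (hτ : 0 < τ.im) :
    slashK K (γ * η) f τ = slashK K η (slashK K γ f) τ := by
  simp only [slashK]
  rw [denom_mul γ η hτ, mact_mul γ η hτ, mul_zpow]
  ring

/-- The values `(1/(2πi))·c/(cτ+d)` for `γ ∈ Γ`. -/
def qmVar (γ : SL2R) (τ : ℂ) : ℂ :=
  (1 / (2 * ↑Real.pi * I)) * ((γ.1 1 0 : ℝ) / ((γ.1 1 0 : ℝ) * τ + (γ.1 1 1 : ℝ)))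

theorem IsLattice.infinite_range_qmVar {Γ : Subgroup SL2R} (hΓ : IsLattice Γ) {τ : ℂ}
    (hτ : 0 < τ.im) : (Set.range fun γ : Γ ↦ qmVar γ τ).Infinite := by
  have hinj : Function.Injective fun x : ℂ ↦ (1 / (2 * ↑Real.pi * I)) * x :=
    mul_right_injective₀ (by simp [Real.pi_ne_zero])
  have := (hΓ.infinite_range hτ).image hinj.injOn
  rwa [← Set.range_comp] at this

theorem HasQMExpansion.slashK_eq {Γ : Subgroup SL2R} {K : ℤ} {n : ℕ} {F : ℂ → ℂ}
    {G : ℕ → ℂ → ℂ} (hG : HasQMExpansion Γ K n F G) {γ : SL2R} (hγ : γ ∈ Γ) {τ : ℂ}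
    (hτ : 0 < τ.im) : slashK K γ F τ = ∑ r ∈ range (n + 1), G r τ * qmVar γ τ ^ r :=
  hG γ hγ τ hτ

theorem HasQMExpansion.coeff_unique {Γ : Subgroup SL2R} (hΓ : IsLattice Γ) {K : ℤ} {n : ℕ}
    {F : ℂ → ℂ} {G G' : ℕ → ℂ → ℂ} (hG : HasQMExpansion Γ K n F G)
    (hG' : HasQMExpansion Γ K n F G') {r : ℕ} (hr : r ≤ n) {τ : ℂ} (hτ : 0 < τ.im) :
    G' r τ = G r τ := by
  refine sum_mul_pow_eq_imp_coeff_eq (hΓ.infinite_range_qmVar hτ) n (G' · τ) (G · τ) ?_ r hr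
  rintro _ ⟨γ, rfl⟩
  exact (hG'.slashK_eq γ.2 hτ).symm.trans (hG.slashK_eq γ.2 hτ)

theorem HasQMExpansion.coeff {Γ : Subgroup SL2R} (hΓ : IsLattice Γ) {K : ℤ} {n : ℕ}
    {F : ℂ → ℂ} {G : ℕ → ℂ → ℂ} (hG : HasQMExpansion Γ K n F G) {r : ℕ} (hr : r ≤ n) :
    HasQMExpansion Γ (K - 2 * r) (n - r) (G r)
      (fun s τ ↦ ((r + s).choose s : ℂ) * G (r + s) τ) := by
  intro η hη τ hτ
  set j : ℂ := (η.1 1 0 : ℝ) * τ + (η.1 1 1 : ℝ) with hj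
  have hj0 : j ≠ 0 := denom_ne_zero_of_im_pos η hτ
  have key := sum_mul_pow_eq_imp_coeff_eq (hΓ.infinite_range_qmVar (mact_im_pos η hτ)) n
    (fun m ↦ j ^ (-K) * G m (mact η τ))
    (fun m ↦ (∑ s ∈ range (n - m + 1),
      ((m + s).choose s : ℂ) * G (m + s) τ * qmVar η τ ^ s) * ((j ^ 2)⁻¹) ^ m) ?_ r hr
  · rw [slashK, ← hj]
    change _ = ∑ s ∈ range (n - r + 1), ((r + s).choose s : ℂ) * G (r + s) τ * qmVar η τ ^ s
    have hz : j ^ (-(K - 2 * r)) = j ^ (-K) * (j ^ 2) ^ r := by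
      rw [← pow_mul, ← zpow_natCast, ← zpow_add₀ hj0]
      congr 1
      push_cast
      ring
    rw [hz, mul_right_comm, key, mul_assoc, ← mul_pow, inv_mul_cancel₀ (pow_ne_zero 2 hj0),
      one_pow, mul_one]
  · rintro _ ⟨γ, rfl⟩
    have h1 := hG.slashK_eq (mul_mem γ.2 hη) hτ
    rw [slashK_mul K γ η F hτ, slashK, hG.slashK_eq γ.2 (mact_im_pos η hτ), ← hj, mul_sum] at h1
    have h2 : qmVar (γ * η) τ = qmVar η τ + (j ^ 2)⁻¹ * qmVar γ (mact η τ) := by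
      rw [qmVar, logDeriv_denom_mul _ _ hτ, qmVar, qmVar]
      ring
    rw [h2, sum_mul_add_pow_eq] at h1
    simpa only [mul_pow, mul_assoc] using h1

/-- Let `F` be a quasimodular form of weight `K` and depth `≤ n` on a lattice `Γ ⊂ SL₂(ℝ)`,
with coefficient family `G` (so `G 0 = F`).  Then the coefficient functions are unique, and,
setting `δ(F) := F₁`, one has `F_r = δ^r(F)/r!` for all `r`; equivalently, each `F_r` is itself
quasimodular of weight `K - 2r` and depth `≤ n - r` with coefficient family
`s ↦ C(r+s,s)·F_{r+s}` (in particular its linear coefficient is `(r+1)·F_{r+1}`, which is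
exactly the statement `F_r = δ^r(F)/r!`). -/
theorem statement11 (Γ : Subgroup SL2R) (hΓ : IsLattice Γ) (K : ℤ) (n : ℕ)
    (F : ℂ → ℂ) (hF : DifferentiableOn ℂ F UHP) (hgrow : ModerateGrowth F)
    (G : ℕ → ℂ → ℂ) (hG0 : G 0 = F) (hexp : HasQMExpansion Γ K n F G) :
    (∀ G' : ℕ → ℂ → ℂ, HasQMExpansion Γ K n F G' →
      ∀ r ≤ n, ∀ τ : ℂ, 0 < τ.im → G' r τ = G r τ)
    ∧ (∀ r ≤ n, HasQMExpansion Γ (K - 2 * r) (n - r) (G r)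
        (fun s τ => ((r + s).choose s : ℂ) * G (r + s) τ)) := by
  exact ⟨fun G' hG' r hr τ hτ ↦ hexp.coeff_unique hΓ hG' hr hτ, fun r hr ↦ hexp.coeff hΓ hr⟩
end
end

section
/- Let h be a holomorphic function on ℍ of suitable decay and let 0 ≤ m ≤ k-2 be integers with k ≥ 2. Then the weight-k holomorphic projection of the almost holomorphic function τ ↦ h(τ)/(τ - τ̄)^m, defined by the Bergman integral π^{hol}_k(Φ)(τ) = ((k-1)/(4π))·∬_ℍ Φ(z)·((z - z̄)/(τ - z̄))^k dV (with dV = y^{-2} dx dy), equals ((-1)^m/(k-m-1)_m)·(d^m h/dτ^m). -/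
open Complex MeasureTheory
open ComplexConjugate

noncomputable section

/-- Rising factorial `x (x+1) ⋯ (x+n-1)` for complex `x`. -/
def risingC (x : ℂ) (n : ℕ) : ℂ := ∏ i ∈ Finset.range n, (x + i)

open Filter Topology Set

lemma one_add_abs_re_le_mul_norm {v : ℂ} {b : ℝ} (hb : 0 < b) (h : b ≤ |v.im|) :
    1 + |v.re| ≤ (1 + 1 / b) * ‖v‖ := by
  have h1 := Complex.abs_re_le_norm v
  have h2 := h.trans (Complex.abs_im_le_norm v)
  have h3 : 1 ≤ 1 / b * ‖v‖ := by
    rw [one_div, inv_mul_eq_div, le_div_iff₀ hb]; linarith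
  linarith

lemma line_sub_ne_zero {s : ℝ} {w : ℂ} (hs : s ≠ w.im) (x : ℝ) : (x : ℂ) + s * I - w ≠ 0 := by
  intro h
  have := congrArg Complex.im h
  simp at this
  exact hs (by linarith)

lemma integrable_div_line_sub_pow {g : ℝ → ℂ} (hg : Continuous g) {B : ℝ} (hB : ∀ x, ‖g x‖ ≤ B)
    {s : ℝ} {w : ℂ} (hs : s ≠ w.im) {n : ℕ} (hn : 2 ≤ n) :
    Integrable (fun x : ℝ => g x / ((x : ℂ) + s * I - w) ^ n) := by
  set b := |s - w.im| with hbdef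
  have hb : 0 < b := abs_pos.mpr (sub_ne_zero.mpr hs)
  have hB0 : 0 ≤ B := (norm_nonneg _).trans (hB 0)
  have hint : Integrable (fun x : ℝ => (1 + ‖x‖) ^ (-(2 : ℝ))) :=
    integrable_one_add_norm (by simp)
  have hint2 := ((hint.comp_sub_right w.re).const_mul (B * (1 + 1 / b) ^ n))
  refine hint2.mono' ?_ (ae_of_all _ fun x => ?_)
  · refine Continuous.aestronglyMeasurable ?_
    exact hg.div (by fun_prop) fun x => pow_ne_zero _ (line_sub_ne_zero hs x)
  · set v : ℂ := (x : ℂ) + s * I - w with hv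
    have h1 : 1 + |x - w.re| ≤ (1 + 1 / b) * ‖v‖ := by
      have := one_add_abs_re_le_mul_norm (v := v) hb (by simp [hv, hbdef])
      simpa [hv] using this
    have hx : 0 ≤ |x - w.re| := abs_nonneg _
    have hvpos : 0 < ‖v‖ := norm_pos_iff.mpr (line_sub_ne_zero hs x)
    have h2 : (1 + |x - w.re|) ^ 2 ≤ ((1 + 1 / b) * ‖v‖) ^ n :=
      (pow_le_pow_right₀ (by linarith) hn).trans (pow_le_pow_left₀ (by linarith) h1 n)
    rw [norm_div, norm_pow, Real.norm_eq_abs, Real.rpow_neg (by linarith)]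
    norm_cast
    rw [mul_assoc, div_eq_mul_inv]
    refine mul_le_mul (hB x) ?_ (by positivity) hB0
    rw [← div_eq_mul_inv, le_div_iff₀ (by positivity), inv_mul_le_iff₀ (by positivity),
      mul_comm, ← mul_pow]
    exact h2

/-- A function holomorphic above a horizontal line, decaying like `‖z - w‖⁻²`, has vanishing
integral along that line. -/
lemma integral_line_eq_zero {G : ℂ → ℂ} {s B : ℝ} {w : ℂ} (hs : s < w.im)
    (hG : DifferentiableOn ℂ G {z | s ≤ z.im})
    (hB : ∀ z : ℂ, s ≤ z.im → z ≠ w → ‖G z‖ ≤ B / ‖z - w‖ ^ 2)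
    (hint : Integrable (fun x : ℝ => G (x + s * I))) :
    ∫ x : ℝ, G (x + s * I) = 0 := by
  have hB0 : 0 ≤ B := by
    have := (norm_nonneg _).trans (hB (w + 1) (by simp; exact hs.le) (by simp))
    simpa using this
  have hlim := intervalIntegral_tendsto_integral hint
    (a := fun R : ℝ => w.re - R) (b := fun R : ℝ => w.re + R) (l := atTop)
    (tendsto_atBot_add_const_left _ _ tendsto_neg_atTop_atBot)
    (tendsto_atTop_add_const_left _ _ tendsto_id)
  refine tendsto_nhds_unique hlim ?_
  have hzero : Tendsto (fun R : ℝ => B * 4 / R + 2 * (B * (w.im - s) / R ^ 2)) atTop (𝓝 0) := by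
    have h1 : Tendsto (fun R : ℝ => B * 4 / R) atTop (𝓝 0) := tendsto_id.const_div_atTop _
    have h2 : Tendsto (fun R : ℝ => B * (w.im - s) / R ^ 2) atTop (𝓝 0) :=
      (tendsto_pow_atTop two_ne_zero).const_div_atTop _
    simpa using h1.add (h2.const_mul 2)
  refine squeeze_zero_norm' ?_ hzero
  filter_upwards [eventually_gt_atTop 0] with R hR
  have hrect := Complex.integral_boundary_rect_eq_zero_of_differentiableOn G
    ⟨w.re - R, s⟩ ⟨w.re + R, w.im + R⟩ (hG.mono ?_)
  swap
  · rintro z ⟨-, hz⟩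
    simp only [mem_preimage] at hz
    rw [uIcc_of_le (by linarith)] at hz
    exact hz.1
  simp only at hrect
  have key : ∀ z : ℂ, s ≤ z.im → R ≤ ‖z - w‖ → ‖G z‖ ≤ B / R ^ 2 := by
    intro z hz hzR
    refine (hB z hz ?_).trans ?_
    · rintro rfl; simp at hzR; linarith
    · gcongr
  have htop : ‖∫ x in (w.re - R)..(w.re + R), G (x + (w.im + R : ℝ) * I)‖
      ≤ B / R ^ 2 * |(w.re + R) - (w.re - R)| := by
    refine intervalIntegral.norm_integral_le_of_norm_le_const fun x _ => key _ ?_ ?_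
    · simp; linarith
    · refine le_trans ?_ (Complex.abs_im_le_norm _)
      simp [abs_of_pos hR]
  have hside : ∀ c : ℝ, |c - w.re| = R →
      ‖∫ y in s..(w.im + R), G (c + y * I)‖ ≤ B / R ^ 2 * |(w.im + R) - s| := by
    intro c hc
    refine intervalIntegral.norm_integral_le_of_norm_le_const fun y hy => key _ ?_ ?_
    · rw [uIoc_of_le (by linarith)] at hy
      simpa using hy.1.le
    · refine le_trans ?_ (Complex.abs_re_le_norm _)
      simp [hc]
  have hr := hside (w.re + R) (by simp [abs_of_pos hR])
  have hl := hside (w.re - R) (by simp [abs_of_pos hR])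
  have heq : ∫ x in (w.re - R)..(w.re + R), G (x + s * I)
      = (∫ x in (w.re - R)..(w.re + R), G (x + (w.im + R : ℝ) * I))
        - I • (∫ y in s..(w.im + R), G ((w.re + R : ℝ) + y * I))
        + I • (∫ y in s..(w.im + R), G ((w.re - R : ℝ) + y * I)) := by
    linear_combination hrect
  rw [heq]
  refine (norm_add_le _ _).trans ((add_le_add_left (norm_sub_le _ _) _).trans ?_)
  rw [norm_smul, norm_smul, norm_I, one_mul, one_mul]
  have e1 : |(w.re + R) - (w.re - R)| = 2 * R := by
    rw [show (w.re + R) - (w.re - R) = 2 * R by ring, abs_of_pos (by linarith)]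
  have e2 : |(w.im + R) - s| = w.im - s + R := by
    rw [abs_of_pos (by linarith)]; ring
  rw [e1] at htop
  rw [e2] at hr hl
  have e3 : B * 4 / R + 2 * (B * (w.im - s) / R ^ 2)
      = B / R ^ 2 * (2 * R) + B / R ^ 2 * (w.im - s + R) + B / R ^ 2 * (w.im - s + R) := by
    field_simp; ring
  rw [e3]
  exact add_le_add (add_le_add htop hr) hl

lemma hasDerivAt_inv_line_sub_pow {s : ℝ} {w : ℂ} (hs : s ≠ w.im) (n : ℕ) (x : ℝ) :
    HasDerivAt (fun x : ℝ => -(((n + 1 : ℕ) : ℂ)⁻¹ / ((x : ℂ) + s * I - w) ^ (n + 1)))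
      (1 / ((x : ℂ) + s * I - w) ^ (n + 2)) x := by
  have hv := line_sub_ne_zero hs x
  have h1 : HasDerivAt (fun x : ℝ => (x : ℂ) + s * I - w) 1 x :=
    ((hasDerivAt_id x).ofReal_comp.add_const _).sub_const _
  have h2 := (((h1.pow (n + 1)).inv (pow_ne_zero _ hv)).const_mul (((n + 1 : ℕ) : ℂ)⁻¹)).neg
  have hn : ((n + 1 : ℕ) : ℂ) ≠ 0 := by exact_mod_cast n.succ_ne_zero
  refine h2.congr_deriv ?_
  simp only [Pi.pow_apply, Nat.add_sub_cancel]
  field_simp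
  ring

lemma tendsto_inv_line_sub {s : ℝ} {w : ℂ} {l : Filter ℝ}
    (hl : Tendsto (fun x : ℝ => |x|) l atTop) :
    Tendsto (fun x : ℝ => ((x : ℂ) + s * I - w)⁻¹) l (𝓝 0) := by
  refine tendsto_inv₀_cobounded.comp (tendsto_norm_atTop_iff_cobounded.mp ?_)
  refine tendsto_atTop_mono (f := fun x : ℝ => |x| - |w.re|) (fun x => ?_)
    (tendsto_atTop_add_const_right _ _ hl)
  refine le_trans ?_ (Complex.abs_re_le_norm _)
  simpa using abs_sub_abs_le_abs_sub x w.re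

lemma integral_one_div_line_sub_sq {s : ℝ} {w : ℂ} (hs : s ≠ w.im) :
    ∫ x : ℝ, 1 / ((x : ℂ) + s * I - w) ^ 2 = 0 := by
  have h := integral_of_hasDerivAt_of_tendsto (fun x => hasDerivAt_inv_line_sub_pow hs 0 x)
    (integrable_div_line_sub_pow (g := fun _ => 1) continuous_const (B := 1) (by simp) hs le_rfl)
    (m := 0) (n := 0) ?_ ?_
  · simpa using h
  · simpa using (tendsto_inv_line_sub (s := s) (w := w) tendsto_abs_atBot_atTop).neg
  · simpa using (tendsto_inv_line_sub (s := s) (w := w) tendsto_abs_atTop_atTop).neg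

lemma integral_div_sub_sq_add_sq (a : ℝ) {b : ℝ} (hb : 0 < b) :
    ∫ x : ℝ, b / ((x - a) ^ 2 + b ^ 2) = Real.pi := by
  rw [integral_sub_right_eq_self (fun x : ℝ => b / (x ^ 2 + b ^ 2)) a]
  have h := Measure.integral_comp_div (fun x : ℝ => (1 + x ^ 2)⁻¹) b
  rw [integral_univ_inv_one_add_sq, smul_eq_mul, abs_of_pos hb] at h
  have : ∀ x : ℝ, b / (x ^ 2 + b ^ 2) = b⁻¹ * (1 + (x / b) ^ 2)⁻¹ := by
    intro x
    have : x ^ 2 + b ^ 2 ≠ 0 := by positivity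
    have : b ^ 2 + x ^ 2 ≠ 0 := by positivity
    have : 1 + (x / b) ^ 2 ≠ 0 := by positivity
    field_simp
    ring
  simp_rw [this]
  rw [integral_const_mul, h]
  field_simp

/-- Cauchy's formula for the first derivative, over a horizontal line below the point. -/
lemma integral_line_div_sq {h : ℂ → ℂ} (hh : DifferentiableOn ℂ h {z | 0 < z.im})
    {s B : ℝ} (hs0 : 0 < s) (hB : ∀ z : ℂ, s ≤ z.im → ‖h z‖ ≤ B) {w : ℂ} (hs : s < w.im) :
    ∫ x : ℝ, h (x + s * I) / ((x : ℂ) + s * I - w) ^ 2 = 2 * Real.pi * I * deriv h w := by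
  set b := w.im - s with hbdef
  have hb : 0 < b := by simp [hbdef, hs]
  set w' : ℂ := w - 2 * b * I with hw'
  have hw'im : w'.im = s - b := by simp [hw', hbdef]; ring
  set φ : ℂ → ℂ := fun z => (2 * b * I) * (z - w) / (z - w') with hφ
  have hne : ∀ z : ℂ, s - b < z.im → z - w' ≠ 0 := by
    intro z hz h0
    have := congrArg Complex.im (sub_eq_zero.mp h0)
    linarith
  have hww' : w - w' = 2 * b * I := by simp [hw']
  set V : Set ℂ := {z | max 0 (s - b) < z.im} with hV
  have hVo : IsOpen V := isOpen_lt continuous_const Complex.continuous_im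
  have hwV : w ∈ V := max_lt (show (0 : ℝ) < w.im by linarith) (show s - b < w.im by linarith)
  have hVn : V ∈ 𝓝 w := hVo.mem_nhds hwV
  have hsV : {z : ℂ | s ≤ z.im} ⊆ V := fun z hz =>
    max_lt (lt_of_lt_of_le hs0 hz) (lt_of_lt_of_le (by linarith) hz)
  have hhV : DifferentiableOn ℂ h V := hh.mono fun z hz =>
    lt_of_le_of_lt (le_max_left 0 (s - b)) (show max 0 (s - b) < z.im from hz)
  have hφV : DifferentiableOn ℂ φ V := by
    refine DifferentiableOn.div (by fun_prop) (by fun_prop) fun z hz => ?_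
    exact hne z ((le_max_right _ _).trans_lt hz)
  set N : ℂ → ℂ := fun z => h z - h w - deriv h w * φ z with hN
  have hNV : DifferentiableOn ℂ N V := (hhV.sub_const _).sub (hφV.const_mul _)
  have hφw : φ w = 0 := by simp [hφ]
  have hNw : N w = 0 := by simp [hN, hφw]
  have hφd : HasDerivAt φ 1 w := by
    have h1 := (((hasDerivAt_id w).sub_const w).const_mul (2 * b * I)).div
      ((hasDerivAt_id w).sub_const w') (hne w (by linarith))
    refine h1.congr_deriv ?_
    have : (2 * b * I : ℂ) ≠ 0 := by simp [hb.ne']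
    simp only [id, sub_self, hww']
    rw [mul_zero, zero_mul, sub_zero, mul_one, ← sq, div_self (pow_ne_zero 2 this)]
  have hNd : deriv N w = 0 := by
    have h1 : HasDerivAt N _ w := ((hhV.differentiableAt hVn).hasDerivAt.sub_const (h w)).sub
      (hφd.const_mul (deriv h w))
    simpa using h1.deriv
  set G := dslope (dslope N w) w with hG
  have hGV : DifferentiableOn ℂ G V :=
    (Complex.differentiableOn_dslope hVn).mpr ((Complex.differentiableOn_dslope hVn).mpr hNV)
  have hGN : ∀ z, z ≠ w → G z = N z / (z - w) ^ 2 := by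
    intro z hz
    have : z - w ≠ 0 := sub_ne_zero.mpr hz
    rw [hG, dslope_of_ne _ hz, slope_def_field, dslope_same, hNd, dslope_of_ne _ hz,
      slope_def_field, hNw]
    field_simp
    ring
  have hφb : ∀ z : ℂ, s ≤ z.im → ‖φ z‖ ≤ 6 * b := by
    intro z hz
    have hz' := hne z (by linarith)
    have h1 : b ≤ ‖z - w'‖ := by
      refine le_trans ?_ ((le_abs_self _).trans (Complex.abs_im_le_norm _))
      simp [hw'im]; linarith
    have h2 : ‖z - w‖ ≤ 3 * ‖z - w'‖ := by
      calc ‖z - w‖ = ‖(z - w') - 2 * b * I‖ := by rw [← hww']; ring_nf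
        _ ≤ ‖z - w'‖ + ‖(2 * b * I : ℂ)‖ := norm_sub_le _ _
        _ = ‖z - w'‖ + 2 * b := by simp [abs_of_pos hb]
        _ ≤ 3 * ‖z - w'‖ := by linarith
    simp only [hφ, norm_div, norm_mul]
    rw [div_le_iff₀ (norm_pos_iff.mpr hz')]
    simp only [Complex.norm_ofNat, norm_I, Complex.norm_real, Real.norm_eq_abs, abs_of_pos hb]
    nlinarith
  have hcont : ∀ {f : ℂ → ℂ}, DifferentiableOn ℂ f V →
      Continuous fun x : ℝ => f (x + s * I) := by
    intro f hf
    refine hf.continuousOn.comp_continuous (by fun_prop) fun x => hsV ?_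
    simp
  have hline : ∀ x : ℝ, s ≤ ((x : ℂ) + s * I).im := fun x => by simp
  have hNb : ∀ z : ℂ, s ≤ z.im → ‖N z‖ ≤ B + ‖h w‖ + ‖deriv h w‖ * (6 * b) := by
    intro z hz
    refine (norm_sub_le _ _).trans (add_le_add ((norm_sub_le _ _).trans ?_) ?_)
    · exact add_le_add (hB z hz) le_rfl
    · rw [norm_mul]
      exact mul_le_mul_of_nonneg_left (hφb z hz) (norm_nonneg _)
  have hlinene : ∀ x : ℝ, (x : ℂ) + s * I ≠ w := fun x =>
    sub_ne_zero.mp (line_sub_ne_zero hs.ne x)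
  have hintN := integrable_div_line_sub_pow (hcont hNV) (fun x => hNb _ (hline x)) hs.ne le_rfl
  have hintφ := integrable_div_line_sub_pow (hcont hφV) (fun x => hφb _ (hline x)) hs.ne le_rfl
  have hint1 := integrable_div_line_sub_pow (g := fun _ => 1) continuous_const (B := 1)
    (by simp) hs.ne le_rfl
  have hGzero : ∫ x : ℝ, G (x + s * I) = 0 := by
    refine integral_line_eq_zero hs (hGV.mono hsV) (B := B + ‖h w‖ + ‖deriv h w‖ * (6 * b)) ?_ ?_
    · intro z hz hzw
      rw [hGN z hzw, norm_div, norm_pow]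
      exact div_le_div_of_nonneg_right (hNb z hz) (by positivity)
    · exact hintN.congr (ae_of_all _ fun x => (hGN _ (hlinene x)).symm)
  have hN0 : ∫ x : ℝ, N (x + s * I) / ((x : ℂ) + s * I - w) ^ 2 = 0 := by
    rw [← hGzero]
    exact integral_congr_ae (ae_of_all _ fun x => (hGN _ (hlinene x)).symm)
  have hφint : ∫ x : ℝ, φ (x + s * I) / ((x : ℂ) + s * I - w) ^ 2 = 2 * Real.pi * I := by
    have : ∀ x : ℝ, φ (x + s * I) / ((x : ℂ) + s * I - w) ^ 2
        = (2 * I) * ((b / ((x - w.re) ^ 2 + b ^ 2) : ℝ) : ℂ) := by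
      intro x
      have hv := line_sub_ne_zero hs.ne x
      have hv' := hne ((x : ℂ) + s * I) (by simp [hb])
      have hprod : ((x : ℂ) + s * I - w) * ((x : ℂ) + s * I - w')
          = (((x - w.re) ^ 2 + b ^ 2 : ℝ) : ℂ) := by
        have e1 : (x : ℂ) + s * I - w = ((x - w.re : ℝ) : ℂ) - b * I := by
          rw [hbdef]
          apply Complex.ext <;> simp
        have e2 : (x : ℂ) + s * I - w' = ((x - w.re : ℝ) : ℂ) + b * I := by
          linear_combination e1 + hww'
        rw [e1, e2]
        push_cast
        linear_combination (-(b : ℂ) ^ 2) * I_sq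
      have hr : (((x - w.re) ^ 2 + b ^ 2 : ℝ) : ℂ) ≠ 0 := hprod ▸ mul_ne_zero hv hv'
      rw [Complex.ofReal_div, ← hprod]
      simp only [hφ]
      field_simp
    simp_rw [this]
    rw [integral_const_mul, integral_complex_ofReal, integral_div_sub_sq_add_sq _ hb]
    ring
  have hsplit : ∀ x : ℝ, h (x + s * I) / ((x : ℂ) + s * I - w) ^ 2
      = N (x + s * I) / ((x : ℂ) + s * I - w) ^ 2
        + h w * (1 / ((x : ℂ) + s * I - w) ^ 2)
        + deriv h w * (φ (x + s * I) / ((x : ℂ) + s * I - w) ^ 2) := by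
    intro x
    simp only [hN]
    ring
  have hintN1 : Integrable (fun x : ℝ => N (x + s * I) / ((x : ℂ) + s * I - w) ^ 2
      + h w * (1 / ((x : ℂ) + s * I - w) ^ 2)) := hintN.add (hint1.const_mul _)
  simp_rw [hsplit]
  rw [integral_add hintN1 (hintφ.const_mul _), integral_add hintN (hint1.const_mul _), integral_const_mul, integral_const_mul, hN0, hφint,
    integral_one_div_line_sub_sq hs.ne]
  ring

lemma isOpen_im_pos : IsOpen {z : ℂ | 0 < z.im} :=
  isOpen_lt continuous_const Complex.continuous_im

lemma differentiableOn_iterate_deriv {h : ℂ → ℂ} (hh : DifferentiableOn ℂ h {z | 0 < z.im})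
    (n : ℕ) : DifferentiableOn ℂ (deriv^[n] h) {z | 0 < z.im} := by
  induction n with
  | zero => simpa
  | succ n ih =>
    rw [Function.iterate_succ_apply']
    exact ih.deriv isOpen_im_pos

/-- Cauchy's estimate on the disc whose radius is half the height of its centre. -/
lemma norm_iterate_deriv_le {h : ℂ → ℂ} (hh : DifferentiableOn ℂ h {z | 0 < z.im}) {z : ℂ}
    (hz : 0 < z.im) {B : ℝ} (hB : ∀ u : ℂ, z.im / 2 ≤ u.im → ‖h u‖ ≤ B) (n : ℕ) :
    ‖deriv^[n] h z‖ ≤ n.factorial * B / (z.im / 2) ^ n := by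
  have hball : ∀ u ∈ Metric.closedBall z (z.im / 2), z.im / 2 ≤ u.im := by
    intro u hu
    rw [mem_closedBall_iff_norm'] at hu
    have := (le_abs_self _).trans ((Complex.abs_im_le_norm (z - u)).trans hu)
    simp at this
    linarith
  rw [← iteratedDeriv_eq_iterate]
  refine Complex.norm_iteratedDeriv_le_of_forall_mem_sphere_norm_le n (by linarith) ?_
    fun u hu => hB u (hball u (Metric.sphere_subset_closedBall hu))
  refine (hh.mono fun u hu => ?_).diffContOnCl
  rw [closure_ball _ (by linarith)] at hu
  exact lt_of_lt_of_le (by linarith) (hball u hu)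

/-- Cauchy's formula for higher derivatives, over a horizontal line below the point. -/
lemma integral_line_div_pow (n : ℕ) {h : ℂ → ℂ} (hh : DifferentiableOn ℂ h {z | 0 < z.im})
    (hB : ∀ s : ℝ, 0 < s → ∃ B : ℝ, ∀ z : ℂ, s ≤ z.im → ‖h z‖ ≤ B) {s : ℝ} (hs0 : 0 < s) {w : ℂ}
    (hs : s < w.im) :
    ∫ x : ℝ, h (x + s * I) / ((x : ℂ) + s * I - w) ^ (n + 2)
      = 2 * Real.pi * I * deriv^[n + 1] h w / (n + 1).factorial := by
  induction n generalizing h with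
  | zero =>
    obtain ⟨B, hB⟩ := hB s hs0
    simpa using integral_line_div_sq hh hs0 hB hs
  | succ n ih =>
    have hh' := hh.deriv isOpen_im_pos
    have hB' : ∀ s : ℝ, 0 < s → ∃ B : ℝ, ∀ z : ℂ, s ≤ z.im → ‖deriv h z‖ ≤ B := by
      intro s hs
      obtain ⟨B, hB⟩ := hB (s / 2) (by linarith)
      have hB0 : 0 ≤ B := (norm_nonneg _).trans (hB (s * I) (by simp; linarith))
      refine ⟨B / (s / 2), fun z hz => ?_⟩
      have h1 := norm_iterate_deriv_le hh (hs.trans_le hz) (B := B)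
        (fun u hu => hB u (by linarith)) 1
      simp only [Function.iterate_one, Nat.factorial_one, Nat.cast_one, one_mul, pow_one] at h1
      refine h1.trans ?_
      gcongr
    have hcont : ∀ {f : ℂ → ℂ}, DifferentiableOn ℂ f {z | 0 < z.im} →
        Continuous fun x : ℝ => f (x + s * I) := by
      intro f hf
      refine hf.continuousOn.comp_continuous (by fun_prop) fun x => ?_
      simpa using hs0
    have hline : ∀ x : ℝ, s ≤ ((x : ℂ) + s * I).im := fun x => by simp
    obtain ⟨B, hBs⟩ := hB s hs0
    obtain ⟨B', hBs'⟩ := hB' s hs0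
    have hu : ∀ x : ℝ, HasDerivAt (fun x : ℝ => h (x + s * I)) (deriv h (x + s * I)) x := by
      intro x
      have h1 : HasDerivAt h (deriv h (x + s * I)) ((x : ℂ) + s * I) :=
        (hh.differentiableAt (isOpen_im_pos.mem_nhds (by simpa using hs0))).hasDerivAt
      have h2 : HasDerivAt (fun x : ℝ => (x : ℂ) + s * I) 1 x :=
        (hasDerivAt_id x).ofReal_comp.add_const _
      exact (h1.comp x h2).congr_deriv (mul_one _)
    have hn : ((n + 1 + 1 : ℕ) : ℂ) ≠ 0 := by exact_mod_cast (n + 1).succ_ne_zero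
    have hparts := integral_mul_deriv_eq_deriv_mul_of_integrable
      (fun x _ => hu x) (fun x _ => hasDerivAt_inv_line_sub_pow hs.ne (n + 1) x) ?_ ?_ ?_
    · have e1 : ∀ x : ℝ, h (x + s * I) / ((x : ℂ) + s * I - w) ^ (n + 1 + 2)
          = h (x + s * I) * (1 / ((x : ℂ) + s * I - w) ^ (n + 1 + 2)) := fun x => by ring
      have e2 : ∀ x : ℝ, deriv h (x + s * I) *
          -(((n + 1 + 1 : ℕ) : ℂ)⁻¹ / ((x : ℂ) + s * I - w) ^ (n + 1 + 1))
          = -((n + 1 + 1 : ℕ) : ℂ)⁻¹ *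
            (deriv h (x + s * I) / ((x : ℂ) + s * I - w) ^ (n + 2)) := fun x => by ring
      simp_rw [e1]
      rw [hparts]
      simp_rw [e2]
      rw [integral_const_mul, ih hh' hB', Nat.factorial_succ (n + 1),
        Function.iterate_succ_apply deriv (n + 1) h]
      have hf : ((n + 1).factorial : ℂ) ≠ 0 := by exact_mod_cast (n + 1).factorial_ne_zero
      push_cast at hn ⊢
      field_simp
    · refine (integrable_div_line_sub_pow (hcont hh) (fun x => hBs _ (hline x)) hs.ne
        (n := n + 1 + 2) (by omega)).congr (ae_of_all _ fun x => ?_)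
      simp only [Pi.mul_apply]
      ring
    · refine ((integrable_div_line_sub_pow (hcont hh') (fun x => hBs' _ (hline x)) hs.ne
        (n := n + 1 + 1) (by omega)).const_mul (-((n + 1 + 1 : ℕ) : ℂ)⁻¹)).congr
        (ae_of_all _ fun x => ?_)
      simp only [Pi.mul_apply]
      ring
    · refine ((integrable_div_line_sub_pow (hcont hh) (fun x => hBs _ (hline x)) hs.ne
        (n := n + 1 + 1) (by omega)).const_mul (-((n + 1 + 1 : ℕ) : ℂ)⁻¹)).congr
        (ae_of_all _ fun x => ?_)
      simp only [Pi.mul_apply]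
      ring

lemma tendsto_pow_mul_of_norm_le {g : ℝ → ℂ} {A δ : ℝ} (hδ : 0 < δ) {n : ℕ}
    (hg : ∀ y : ℝ, 0 ≤ y → ‖g y‖ ≤ A * (1 + y) ^ (-(n + δ))) :
    Tendsto (fun y : ℝ => (y : ℂ) ^ n * g y) atTop (𝓝 0) := by
  have hlim : Tendsto (fun y : ℝ => A * (1 + y) ^ (-δ)) atTop (𝓝 0) := by
    simpa using ((tendsto_rpow_neg_atTop hδ).comp
      (tendsto_atTop_add_const_left atTop (1 : ℝ) tendsto_id)).const_mul A
  refine squeeze_zero_norm' ?_ hlim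
  filter_upwards [eventually_ge_atTop 0] with y hy
  rw [norm_mul, norm_pow, Complex.norm_real, Real.norm_eq_abs, abs_of_nonneg hy]
  have h1 : (0 : ℝ) < 1 + y := by linarith
  have hA : 0 ≤ A * (1 + y) ^ (-(n + δ)) := (norm_nonneg _).trans (hg y hy)
  calc y ^ n * ‖g y‖ ≤ (1 + y) ^ n * (A * (1 + y) ^ (-(n + δ))) := by
        gcongr
        · linarith
        · exact hg y hy
    _ = A * (1 + y) ^ (-δ) := by
        rw [← Real.rpow_natCast (1 + y) n, mul_left_comm, ← Real.rpow_add h1]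
        congr 2
        ring

lemma integrableOn_pow_mul_of_norm_le {g : ℝ → ℂ} (hc : ContinuousOn g (Ici 0)) {A δ : ℝ}
    (hδ : 0 < δ) {n : ℕ}
    (hg : ∀ y : ℝ, 0 ≤ y → ‖g y‖ ≤ A * (1 + y) ^ (-((n + 1 : ℕ) + δ))) :
    IntegrableOn (fun y : ℝ => (y : ℂ) ^ n * g y) (Ioi 0) := by
  have hint : Integrable (fun y : ℝ => (1 + ‖y‖) ^ (-(1 + δ))) :=
    integrable_one_add_norm (by simpa using hδ)
  refine (hint.const_mul A).integrableOn.mono' ?_ ?_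
  · refine ContinuousOn.aestronglyMeasurable ?_ measurableSet_Ioi
    exact ContinuousOn.mul (by fun_prop) (hc.mono Ioi_subset_Ici_self)
  · refine (ae_restrict_mem measurableSet_Ioi).mono fun y hy => ?_
    have hy : 0 < y := hy
    rw [norm_mul, norm_pow, Complex.norm_real, Real.norm_eq_abs, abs_of_pos hy]
    have h1 : (0 : ℝ) < 1 + y := by linarith
    have hA : 0 ≤ A * (1 + y) ^ (-((n + 1 : ℕ) + δ)) := (norm_nonneg _).trans (hg y hy.le)
    calc y ^ n * ‖g y‖ ≤ (1 + y) ^ n * (A * (1 + y) ^ (-((n + 1 : ℕ) + δ))) := by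
          gcongr
          · linarith
          · exact hg y hy.le
      _ = A * (1 + y) ^ (-(1 + δ)) := by
          rw [← Real.rpow_natCast (1 + y) n, mul_left_comm, ← Real.rpow_add h1]
          congr 2
          push_cast
          ring

/-- Repeated integration by parts on the half-line. -/
lemma integral_Ioi_pow_mul_iterated_deriv {f : ℕ → ℝ → ℂ} {A : ℕ → ℝ} {δ : ℝ} (hδ : 0 < δ)
    (hf : ∀ j, ∀ y : ℝ, 0 ≤ y → HasDerivAt (f j) (f (j + 1) y) y)
    (hA : ∀ j, ∀ y : ℝ, 0 ≤ y → ‖f j y‖ ≤ A j * (1 + y) ^ (-(j + δ))) (n : ℕ) :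
    ∫ y in Ioi (0 : ℝ), (y : ℂ) ^ n * f (n + 1) y = (-1) ^ (n + 1) * n.factorial * f 0 0 := by
  have hc : ∀ j, ContinuousOn (f j) (Ici 0) := fun j y hy =>
    (hf j y hy).continuousAt.continuousWithinAt
  have hint : ∀ j, IntegrableOn (fun y : ℝ => (y : ℂ) ^ j * f (j + 1) y) (Ioi 0) := fun j =>
    integrableOn_pow_mul_of_norm_le (hc _) hδ (hA (j + 1))
  have hlim : ∀ j, Tendsto (fun y : ℝ => (y : ℂ) ^ j * f j y) atTop (𝓝 0) := fun j =>
    tendsto_pow_mul_of_norm_le hδ (hA j)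
  induction n with
  | zero =>
    have h := integral_Ioi_of_hasDerivAt_of_tendsto' (fun y hy => hf 0 y hy)
      (by simpa using hint 0) (by simpa using hlim 0)
    simpa using h
  | succ n ih =>
    have hd : ∀ y ∈ Ici (0 : ℝ), HasDerivAt (fun y : ℝ => (y : ℂ) ^ (n + 1) * f (n + 1) y)
        ((n + 1 : ℂ) * ((y : ℂ) ^ n * f (n + 1) y) + (y : ℂ) ^ (n + 1) * f (n + 1 + 1) y) y := by
      intro y hy
      have h1 := ((hasDerivAt_id y).ofReal_comp.pow (n + 1)).mul (hf (n + 1) y hy)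
      refine h1.congr_deriv ?_
      simp
      ring
    have h := integral_Ioi_of_hasDerivAt_of_tendsto' hd
      (((hint n).const_mul _).add (hint (n + 1))) (hlim (n + 1))
    rw [integral_add ((hint n).const_mul _) (hint (n + 1)), integral_const_mul, ih] at h
    simp only [ne_eq, Nat.succ_ne_zero, not_false_eq_true, ofReal_zero, zero_pow, zero_mul,
      sub_zero] at h
    rw [Nat.factorial_succ]
    push_cast
    linear_combination h

lemma integrableOn_bergman {h : ℂ → ℂ} (hh : DifferentiableOn ℂ h {z | 0 < z.im}) {C δ : ℝ}
    (hδ : 0 < δ) (hδ1 : δ ≤ 1)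
    (hdecay : ∀ z : ℂ, 0 < z.im → ‖h z‖ ≤ C / (1 + z.im) ^ δ) (n m : ℕ) {τ : ℂ} (hτ : 0 < τ.im) :
    IntegrableOn (fun p : ℝ × ℝ => (p.2 : ℂ) ^ n *
      (h (p.1 + p.2 * I) / ((p.1 : ℂ) + p.2 * I - (τ + 2 * p.2 * I)) ^ (n + m + 2)))
      (univ ×ˢ Ioi 0) := by
  set b := τ.im with hb
  set K := 1 + 1 / b with hK
  have hK0 : 0 < K := by positivity
  have hint : Integrable (fun x : ℝ => (1 + ‖x‖) ^ (-(1 + δ / 2))) :=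
    integrable_one_add_norm (by simpa using hδ)
  have hprod := (((hint.comp_sub_right τ.re).mul_prod hint).const_mul (C * (K ^ 2 / b ^ m)))
  refine (hprod.integrableOn (s := univ ×ˢ Ioi 0)).mono' ?_ ?_
  · refine ContinuousOn.aestronglyMeasurable ?_ (MeasurableSet.univ.prod measurableSet_Ioi)
    refine ContinuousOn.mul (by fun_prop) (ContinuousOn.div ?_ (by fun_prop) ?_)
    · refine hh.continuousOn.comp (by fun_prop) fun p hp => ?_
      simpa using hp.2
    · rintro p ⟨-, hp⟩
      have hp : 0 < p.2 := hp
      refine pow_ne_zero _ (line_sub_ne_zero ?_ _)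
      simp
      linarith
  · refine (ae_restrict_mem (MeasurableSet.univ.prod measurableSet_Ioi)).mono ?_
    rintro ⟨x, y⟩ ⟨-, hy⟩
    have hy : 0 < y := hy
    set v : ℂ := (x : ℂ) + y * I - (τ + 2 * y * I) with hv
    have hre : v.re = x - τ.re := by simp [hv]
    have him : v.im = -(y + b) := by simp [hv, hb]; ring
    have habs : |v.im| = y + b := by rw [him, abs_neg, abs_of_pos (by linarith)]
    have hvy : y + b ≤ ‖v‖ := habs ▸ Complex.abs_im_le_norm v
    have hv0 : 0 < ‖v‖ := by linarith
    have hX : 1 + |x - τ.re| ≤ K * ‖v‖ := by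
      rw [← hre]
      exact one_add_abs_re_le_mul_norm hτ (by linarith)
    have hY : 1 + y ≤ K * ‖v‖ := by
      have : 1 ≤ 1 / b * ‖v‖ := by
        rw [one_div, inv_mul_eq_div, le_div_iff₀ hτ]; linarith
      rw [hK]; linarith
    have hX0 : 0 < 1 + |x - τ.re| := by positivity
    have hY0 : 0 < 1 + y := by linarith
    have hxy : (1 + |x - τ.re|) ^ (1 + δ / 2) * (1 + y) ^ (1 - δ / 2) ≤ K ^ 2 * ‖v‖ ^ 2 := by
      calc (1 + |x - τ.re|) ^ (1 + δ / 2) * (1 + y) ^ (1 - δ / 2)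
          ≤ (K * ‖v‖) ^ (1 + δ / 2) * (K * ‖v‖) ^ (1 - δ / 2) := by
            gcongr
            linarith
        _ = K ^ 2 * ‖v‖ ^ 2 := by
            rw [← Real.rpow_add (by positivity), ← mul_pow, ← Real.rpow_natCast]
            congr 1
            push_cast
            ring
    have hpow : y ^ n * b ^ m * ‖v‖ ^ 2 ≤ ‖v‖ ^ (n + m + 2) := by
      rw [pow_add, pow_add]
      gcongr <;> linarith
    have hker : y ^ n / ‖v‖ ^ (n + m + 2) ≤ K ^ 2 / b ^ m *
        ((1 + |x - τ.re|) ^ (-(1 + δ / 2)) * (1 + y) ^ (-(1 - δ / 2))) := by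
      rw [Real.rpow_neg hX0.le, Real.rpow_neg hY0.le, ← mul_inv, ← div_eq_mul_inv, div_div,
        div_le_div_iff₀ (by positivity) (by positivity)]
      calc y ^ n * (b ^ m * ((1 + |x - τ.re|) ^ (1 + δ / 2) * (1 + y) ^ (1 - δ / 2)))
          ≤ y ^ n * (b ^ m * (K ^ 2 * ‖v‖ ^ 2)) := by gcongr
        _ = K ^ 2 * (y ^ n * b ^ m * ‖v‖ ^ 2) := by ring
        _ ≤ K ^ 2 * ‖v‖ ^ (n + m + 2) := by gcongr
    have hhb := hdecay ((x : ℂ) + y * I) (by simpa using hy)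
    simp only [add_im, ofReal_im, mul_im, ofReal_re, I_im, mul_one, I_re, mul_zero, add_zero,
      zero_add] at hhb
    have hYY : (1 + y) ^ (-(1 + δ / 2)) = (1 + y) ^ (-(1 - δ / 2)) * ((1 + y) ^ δ)⁻¹ := by
      rw [← Real.rpow_neg hY0.le, ← Real.rpow_add hY0]
      congr 1
      ring
    simp only [norm_mul, norm_div, norm_pow, Complex.norm_real, Real.norm_eq_abs, abs_of_pos hy]
    rw [hYY]
    calc y ^ n * (‖h (x + y * I)‖ / ‖v‖ ^ (n + m + 2))
        = (y ^ n / ‖v‖ ^ (n + m + 2)) * ‖h (x + y * I)‖ := by ring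
      _ ≤ (K ^ 2 / b ^ m *
        ((1 + |x - τ.re|) ^ (-(1 + δ / 2)) * (1 + y) ^ (-(1 - δ / 2)))) * (C / (1 + y) ^ δ) := by
          gcongr
      _ = _ := by ring

lemma integral_upperHalfPlane_eq {g : ℂ → ℂ}
    (hg : IntegrableOn (fun p : ℝ × ℝ => g (p.1 + p.2 * I)) (univ ×ˢ Ioi 0)) :
    ∫ z in {z : ℂ | 0 < z.im}, g z = ∫ y in Ioi (0 : ℝ), ∫ x : ℝ, g (x + y * I) := by
  have he := Complex.volume_preserving_equiv_real_prod.symm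
  rw [← he.setIntegral_preimage_emb Complex.measurableEquivRealProd.symm.measurableEmbedding]
  have hpre : Complex.measurableEquivRealProd.symm ⁻¹' {z : ℂ | 0 < z.im}
      = (univ : Set ℝ) ×ˢ Ioi (0 : ℝ) := by
    ext p
    simp [Complex.measurableEquivRealProd_symm_apply]
  have hmk : ∀ p : ℝ × ℝ, Complex.measurableEquivRealProd.symm p = p.1 + p.2 * I := fun p => by
    rw [Complex.measurableEquivRealProd_symm_apply, Complex.mk_eq_add_mul_I]
  rw [hpre]
  simp_rw [hmk]
  rw [IntegrableOn, Measure.volume_eq_prod, ← Measure.prod_restrict, Measure.restrict_univ] at hg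
  rw [Measure.volume_eq_prod, ← Measure.prod_restrict, Measure.restrict_univ,
    integral_prod_symm _ hg]

lemma integral_Ioi_pow_mul_iterate_deriv {h : ℂ → ℂ} (hh : DifferentiableOn ℂ h {z | 0 < z.im})
    {C δ : ℝ} (hδ : 0 < δ) (hC : 0 < C)
    (hdecay : ∀ z : ℂ, 0 < z.im → ‖h z‖ ≤ C / (1 + z.im) ^ δ) (n m : ℕ) {τ : ℂ} (hτ : 0 < τ.im) :
    ∫ y in Ioi (0 : ℝ), (y : ℂ) ^ n * deriv^[n + m + 1] h (τ + 2 * y * I)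
      = (-1) ^ (n + 1) * n.factorial / (2 * I) ^ (n + 1) * deriv^[m] h τ := by
  set b := min (τ.im / 2) 1 with hb
  have hb0 : 0 < b := lt_min (by linarith) one_pos
  have him : ∀ y : ℝ, (τ + 2 * y * I).im = τ.im + 2 * y := fun y => by simp
  have hbound : ∀ j, ∀ y : ℝ, 0 ≤ y → ‖(2 * I) ^ j * deriv^[m + j] h (τ + 2 * y * I)‖
      ≤ (2 ^ j * ((m + j).factorial * (C * b ^ (-δ)) / b ^ (m + j))) * (1 + y) ^ (-(j + δ)) := by
    intro j y hy
    have hY : 0 < 1 + y := by linarith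
    have hby : b * (1 + y) ≤ (τ + 2 * y * I).im / 2 := by
      rw [him]
      have h1 : b ≤ τ.im / 2 := min_le_left _ _
      have h2 : b ≤ 1 := min_le_right _ _
      nlinarith
    have hpos : 0 < b * (1 + y) := mul_pos hb0 hY
    have hz : 0 < (τ + 2 * y * I).im := by linarith
    have h1 := norm_iterate_deriv_le hh hz (B := C * (b * (1 + y)) ^ (-δ)) (fun u hu => by
      refine (hdecay u (by linarith)).trans ?_
      rw [div_eq_mul_inv, Real.rpow_neg hpos.le]
      gcongr
      linarith) (m + j)
    rw [norm_mul, norm_pow, norm_mul, norm_I, Complex.norm_ofNat, mul_one,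
      mul_assoc ((2 : ℝ) ^ j)]
    refine mul_le_mul_of_nonneg_left ?_ (by positivity)
    calc ‖deriv^[m + j] h (τ + 2 * y * I)‖
        ≤ (m + j).factorial * (C * (b * (1 + y)) ^ (-δ)) / ((τ + 2 * y * I).im / 2) ^ (m + j) := h1
      _ ≤ (m + j).factorial * (C * (b * (1 + y)) ^ (-δ)) / (b ^ (m + j) * (1 + y) ^ j) := by
        gcongr
        calc b ^ (m + j) * (1 + y) ^ j ≤ b ^ (m + j) * (1 + y) ^ (m + j) := by
              gcongr
              · linarith
              · omega
          _ = (b * (1 + y)) ^ (m + j) := (mul_pow _ _ _).symm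
          _ ≤ _ := by gcongr
      _ = (m + j).factorial * (C * b ^ (-δ)) / b ^ (m + j) * (1 + y) ^ (-(j + δ)) := by
        rw [Real.mul_rpow hb0.le hY.le, neg_add, Real.rpow_add hY, Real.rpow_neg hY.le (j : ℝ),
          Real.rpow_natCast]
        field_simp
  have hder : ∀ j, ∀ y : ℝ, 0 ≤ y →
      HasDerivAt (fun y : ℝ => (2 * I) ^ j * deriv^[m + j] h (τ + 2 * y * I))
        ((2 * I) ^ (j + 1) * deriv^[m + (j + 1)] h (τ + 2 * y * I)) y := by
    intro j y hy
    have h1 : HasDerivAt (deriv^[m + j] h) (deriv^[m + (j + 1)] h (τ + 2 * y * I))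
        (τ + 2 * y * I) := by
      rw [← add_assoc, Function.iterate_succ_apply']
      refine ((differentiableOn_iterate_deriv hh _).differentiableAt
        (isOpen_im_pos.mem_nhds ?_)).hasDerivAt
      change 0 < (τ + 2 * y * I).im
      rw [him]
      linarith
    have h2 : HasDerivAt (fun y : ℝ => τ + 2 * y * I) (2 * 1 * I) y :=
      (((hasDerivAt_id y).ofReal_comp.const_mul 2).mul_const I).const_add τ
    refine ((h1.comp y h2).const_mul ((2 * I) ^ j)).congr_deriv ?_
    ring
  have key := integral_Ioi_pow_mul_iterated_deriv hδ hder hbound n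
  have hI : (2 * I : ℂ) ^ (n + 1) ≠ 0 := by simp
  have hre : ∀ y : ℝ, (y : ℂ) ^ n * ((2 * I) ^ (n + 1) * deriv^[m + (n + 1)] h (τ + 2 * y * I))
      = (2 * I) ^ (n + 1) * ((y : ℂ) ^ n * deriv^[n + m + 1] h (τ + 2 * y * I)) := by
    intro y
    rw [show m + (n + 1) = n + m + 1 by omega]
    ring
  simp_rw [hre] at key
  rw [integral_const_mul] at key
  simp only [pow_zero, one_mul, add_zero, ofReal_zero, mul_zero, zero_mul] at key
  rw [div_mul_eq_mul_div, eq_div_iff hI, ← key]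
  ring

lemma risingC_mul_factorial (n m : ℕ) :
    risingC ((n : ℂ) + 1) m * n.factorial = (n + m).factorial := by
  induction m with
  | zero => simp [risingC]
  | succ m ih =>
    rw [risingC, Finset.prod_range_succ, ← risingC, ← add_assoc n m 1, Nat.factorial_succ]
    push_cast
    linear_combination ((n : ℂ) + 1 + m) * ih

/-- Let `h` be holomorphic on `ℍ` of suitable decay and `0 ≤ m ≤ k-2`.  Then the weight-`k`
holomorphic projection of `τ ↦ h(τ)/(τ-τ̄)^m`, defined by the Bergman integral
`π^{hol}_k(Φ)(τ) = ((k-1)/(4π))·∬_ℍ Φ(z)·((z-z̄)/(τ-z̄))^k dV` with `dV = y⁻² dx dy`,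
equals `((-1)^m/(k-m-1)_m)·d^m h/dτ^m`. -/
theorem statement19 (h : ℂ → ℂ)
    (hhol : DifferentiableOn ℂ h {z : ℂ | 0 < z.im})
    (hdecay : ∃ C > (0 : ℝ), ∃ δ > (0 : ℝ), ∀ z : ℂ, 0 < z.im →
      ‖h z‖ ≤ C / (1 + z.im) ^ δ)
    (k m : ℕ) (hk : 2 ≤ k) (hm : m ≤ k - 2) (τ : ℂ) (hτ : 0 < τ.im) :
    (((k : ℂ) - 1) / (4 * ↑Real.pi)) *
        ∫ z in {z : ℂ | 0 < z.im},
          (h z / (z - conj z) ^ m) * ((z - conj z) / (τ - conj z)) ^ k *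
            (1 / (z.im : ℂ) ^ 2)
      = ((-1 : ℂ) ^ m / risingC ((k : ℂ) - (m : ℂ) - 1) m) * deriv^[m] h τ := by
  obtain ⟨C, hC, δ₀, hδ₀, hdec⟩ := hdecay
  obtain ⟨n, rfl⟩ : ∃ n, k = n + m + 2 := ⟨k - m - 2, by omega⟩
  set δ := min δ₀ 1 with hδdef
  have hδ : 0 < δ := lt_min hδ₀ one_pos
  have hdecay : ∀ z : ℂ, 0 < z.im → ‖h z‖ ≤ C / (1 + z.im) ^ δ := by
    intro z hz
    refine (hdec z hz).trans ?_
    gcongr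
    · linarith
    · exact min_le_left _ _
  have hbdd : ∀ s : ℝ, 0 < s → ∃ B : ℝ, ∀ z : ℂ, s ≤ z.im → ‖h z‖ ≤ B := by
    refine fun s hs => ⟨C, fun z hz => (hdecay z (hs.trans_le hz)).trans ?_⟩
    exact div_le_self hC.le (Real.one_le_rpow (by linarith) hδ.le)
  set c : ℂ := (2 * I) ^ (n + 2) * (-1) ^ (n + m + 2) with hc
  have hform : ∀ x y : ℝ, 0 < y →
      (h (x + y * I) / ((x + y * I : ℂ) - conj (x + y * I : ℂ)) ^ m) *
        (((x + y * I : ℂ) - conj (x + y * I : ℂ)) / (τ - conj (x + y * I : ℂ))) ^ (n + m + 2) *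
          (1 / ((x + y * I : ℂ).im : ℂ) ^ 2)
      = c * ((y : ℂ) ^ n *
        (h (x + y * I) / ((x : ℂ) + y * I - (τ + 2 * y * I)) ^ (n + m + 2))) := by
    intro x y hy
    have hy' : (y : ℂ) ≠ 0 := by exact_mod_cast hy.ne'
    have e1 : (x + y * I : ℂ) - conj (x + y * I : ℂ) = 2 * I * y := by
      simp only [map_add, map_mul, conj_ofReal, conj_I]; ring
    have e2 : τ - conj (x + y * I : ℂ) = -((x : ℂ) + y * I - (τ + 2 * y * I)) := by
      simp only [map_add, map_mul, conj_ofReal, conj_I]; ring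
    have e3 : (x + y * I : ℂ).im = y := by simp
    have hv : (x : ℂ) + y * I - (τ + 2 * y * I) ≠ 0 := by
      refine line_sub_ne_zero ?_ x
      simp
      linarith
    rw [e1, e2, e3, hc, neg_eq_neg_one_mul, div_pow, mul_pow (-1 : ℂ), mul_pow (2 * I),
      mul_pow (2 * I)]
    have hs : ((-1 : ℂ) ^ (n + m + 2)) * (-1) ^ (n + m + 2) = 1 := by
      rw [← mul_pow]; simp
    rw [div_mul_div_comm, div_mul_div_comm, ← mul_div_assoc, ← mul_div_assoc, div_eq_div_iff]
    · linear_combination (-(h (x + y * I)) * (2 * I) ^ (n + m + 2) * (y : ℂ) ^ (n + m + 2) *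
        ((x : ℂ) + y * I - (τ + 2 * y * I)) ^ (n + m + 2)) * hs
    · simp [hy', hv]
    · exact pow_ne_zero _ hv
  have hint := integrableOn_bergman hhol hδ (min_le_right _ _) hdecay n m hτ
  rw [integral_upperHalfPlane_eq]
  swap
  · refine IntegrableOn.congr_fun (hint.const_mul c) (fun p hp => ?_)
      (MeasurableSet.univ.prod measurableSet_Ioi)
    exact (hform p.1 p.2 hp.2).symm
  have hinner : ∀ y ∈ Ioi (0 : ℝ), (∫ x : ℝ,
      (h (x + y * I) / ((x + y * I : ℂ) - conj (x + y * I : ℂ)) ^ m) *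
        (((x + y * I : ℂ) - conj (x + y * I : ℂ)) / (τ - conj (x + y * I : ℂ))) ^ (n + m + 2) *
          (1 / ((x + y * I : ℂ).im : ℂ) ^ 2))
      = (c * (2 * Real.pi * I) / (n + m + 1).factorial) *
        ((y : ℂ) ^ n * deriv^[n + m + 1] h (τ + 2 * y * I)) := by
    intro y hy
    have hy : 0 < y := hy
    simp_rw [fun x : ℝ => hform x y hy]
    rw [integral_const_mul, integral_const_mul,
      integral_line_div_pow (n + m) hhol hbdd hy (by simp; linarith)]
    ring
  rw [setIntegral_congr_fun measurableSet_Ioi hinner, integral_const_mul,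
    integral_Ioi_pow_mul_iterate_deriv hhol hδ hC hdecay n m hτ, hc]
  have hrise := risingC_mul_factorial n m
  have hnf : (n.factorial : ℂ) ≠ 0 := by exact_mod_cast n.factorial_ne_zero
  have hnmf : ((n + m).factorial : ℂ) ≠ 0 := by exact_mod_cast (n + m).factorial_ne_zero
  have hr0 : risingC ((n : ℂ) + 1) m ≠ 0 := by
    intro h0
    rw [h0, zero_mul] at hrise
    exact hnmf hrise.symm
  have hnm : ((n : ℂ) + m + 1) ≠ 0 := by exact_mod_cast (n + m).succ_ne_zero
  have hpi : (Real.pi : ℂ) ≠ 0 := by exact_mod_cast Real.pi_ne_zero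
  have hsign : ((-1 : ℂ) ^ n) * (-1) ^ n = 1 := by rw [← mul_pow]; simp
  have hI : (2 * I : ℂ) ^ (n + 1) ≠ 0 := by simp
  have ek : ((n + m + 2 : ℕ) : ℂ) - 1 = n + m + 1 := by push_cast; ring
  have er : ((n + m + 2 : ℕ) : ℂ) - m - 1 = n + 1 := by push_cast; ring
  rw [er, ek, Nat.factorial_succ, Nat.cast_mul, ← hrise, pow_succ (2 * I) (n + 1)]
  push_cast
  field_simp
  rw [I_sq, pow_add _ (n + m) 2, pow_add _ n m, pow_succ _ n]
  linear_combination (4 * deriv^[m] h τ * (-1) ^ m) * hsign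
end
end
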